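/- With the notation of the half-form pairing: for Lagrangian subspaces Γ₁ and Γ₂ of a 2n-dimensional symplectic vector space E with compatible complex structure J, where Γ₂ corresponds to the symmetric endomorphism A of JΓ₁, the pairing (α,β)_{Γ₁,Γ₂} on Λ^{n,0}E* satisfies (α,β)_{Γ₁,Γ₂} = 2^{−n} det(1 − iA)(α,β), where (α,β) = i^{n(2−n)} α ∧ β̄ / ω^n is the Hermitian product. -/

import Mathlib

open scoped TensorProduct

/-- Complex conjugate of a `ℂ`-valued alternating form. -/
noncomputable def conjAlt {E : Type*} [AddCommGroup E] [Module ℝ E] {n : ℕ}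
    (β : E [⋀^Fin n]→ₗ[ℝ] ℂ) : E [⋀^Fin n]→ₗ[ℝ] ℂ :=
  (Complex.conjLIE.toLinearIsometry.toLinearMap).compAlternatingMap β

/-- Wedge product of two `ℂ`-valued alternating forms (shuffle convention). -/
noncomputable def wedgeC {E : Type*} [AddCommGroup E] [Module ℝ E] {p q : ℕ}
    (α : E [⋀^Fin p]→ₗ[ℝ] ℂ) (β : E [⋀^Fin q]→ₗ[ℝ] ℂ) :
    E [⋀^Fin (p + q)]→ₗ[ℝ] ℂ :=
  ((LinearMap.mul' ℝ ℂ).compAlternatingMap (α.domCoprod β)).domDomCongr finSumFinEquiv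

/-- The wedge product of two determinants of coordinate functionals is the determinant of all of
the functionals together. -/
theorem wedgeC_apply_of_eq_mul_det {E : Type*} [AddCommGroup E] [Module ℝ E] {p q : ℕ}
    {α : E [⋀^Fin p]→ₗ[ℝ] ℂ} {β : E [⋀^Fin q]→ₗ[ℝ] ℂ} {a b : ℂ}
    {x : Fin p → E →ₗ[ℝ] ℂ} {y : Fin q → E →ₗ[ℝ] ℂ}
    (hα : ∀ w, α w = a * (Matrix.of fun i k => x i (w k)).det)
    (hβ : ∀ w, β w = b * (Matrix.of fun i k => y i (w k)).det)
    (v : Fin (p + q) → E) :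
    wedgeC α β v =
      a * b * (Matrix.of fun i k => Sum.elim x y i (v (finSumFinEquiv k))).det := by
  have key : ∀ {r : ℕ} (γ : E [⋀^Fin r]→ₗ[ℝ] ℂ) (c : ℂ) (z : Fin r → E →ₗ[ℝ] ℂ),
      (∀ w, γ w = c * (Matrix.of fun i k => z i (w k)).det) →
      γ = MultilinearMap.alternatization
        (c • (MultilinearMap.mkPiAlgebra ℝ (Fin r) ℂ).compLinearMap z) := by
    intro r γ c z h
    ext w
    rw [h, MultilinearMap.alternatization_apply, ← Matrix.det_transpose, Matrix.det_apply,
      Finset.mul_sum]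
    refine Finset.sum_congr rfl fun σ _ => ?_
    simp [mul_smul_comm]
  rw [key α a x hα, key β b y hβ, wedgeC, ← MultilinearMap.domCoprod_alternization,
    ← LinearMap.compMultilinearMap_alternatization, AlternatingMap.domDomCongr_apply,
    MultilinearMap.alternatization_apply, ← Matrix.det_transpose, Matrix.det_apply,
    Finset.mul_sum]
  refine Finset.sum_congr rfl fun σ _ => ?_
  simp [mul_smul_comm, Fintype.prod_sum_type, mul_mul_mul_comm]

/-- A complex frame `e` of a real vector space with complex structure `J` gives complex
coordinates, and every `J`-complex-linear form of top degree is a multiple of their determinant. -/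
theorem exists_complex_coordinates {E : Type*} [AddCommGroup E] [Module ℝ E]
    [FiniteDimensional ℝ E] {n : ℕ} (hdim : Module.finrank ℝ E = 2 * n)
    (J : E →ₗ[ℝ] E) (hJ2 : J ∘ₗ J = -LinearMap.id) (e : Fin n → E)
    (he : ∀ x y : Fin n → ℝ, ∑ k, x k • e k + J (∑ k, y k • e k) = 0 → x = 0 ∧ y = 0) :
    ∃ z : Fin n → E →ₗ[ℝ] ℂ,
      (∀ w, ∑ k, (z k w).re • e k + J (∑ k, (z k w).im • e k) = w) ∧
      (∀ k j, z k (e j) = if j = k then 1 else 0) ∧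
      (∀ k w, z k (J w) = Complex.I * z k w) ∧
      ∀ γ : E [⋀^Fin n]→ₗ[ℝ] ℂ,
        (∀ (v : Fin n → E) (k : Fin n),
          γ (Function.update v k (J (v k))) = Complex.I * γ v) →
        ∀ v, γ v = γ e * (Matrix.of fun i k => z i (v k)).det := by
  let _ : Module ℂ E := Module.compHom E
    (Complex.lift ⟨J, by rw [Module.End.mul_eq_comp, hJ2]; rfl⟩ :
      ℂ →ₐ[ℝ] Module.End ℝ E).toRingHom
  have hsmul : ∀ (c : ℂ) (w : E), c • w = c.re • w + c.im • J w := fun c w => by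
    change (Complex.lift ⟨J, _⟩ : ℂ →ₐ[ℝ] Module.End ℝ E) c w = _
    simp [Complex.liftAux_apply]
  have : IsScalarTower ℝ ℂ E := ⟨fun r c w => by simp [hsmul, smul_smul]⟩
  have hI : ∀ w : E, Complex.I • w = J w := fun w => by simp [hsmul]
  have hsum : ∀ g : Fin n → ℂ,
      ∑ k, g k • e k = ∑ k, (g k).re • e k + J (∑ k, (g k).im • e k) := fun g => by
    simp [hsmul, Finset.sum_add_distrib]
  have hli : LinearIndependent ℂ e := by
    rw [Fintype.linearIndependent_iff]
    intro g hg k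
    rw [hsum] at hg
    obtain ⟨h₁, h₂⟩ := he _ _ hg
    exact Complex.ext (congrFun h₁ k) (congrFun h₂ k)
  have hrank : Module.finrank ℂ E = n := by
    have := Module.finrank_mul_finrank ℝ ℂ E
    rw [Complex.finrank_real_complex] at this
    omega
  have : Module.Finite ℂ E := Module.Finite.of_restrictScalars_finite ℝ ℂ E
  let b : Module.Basis (Fin n) ℂ E :=
    Module.Basis.mk hli (hli.span_eq_top_of_card_eq_finrank' (by simp [hrank])).ge
  have hb : ⇑b = e := Module.Basis.coe_mk _ _
  refine ⟨fun k => (b.coord k).restrictScalars ℝ, fun w => ?_, fun k j => ?_, fun k w => ?_,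
    fun γ hγ v => ?_⟩
  · rw [← hsum, ← hb]
    exact b.sum_repr w
  · simp [← hb, Finsupp.single_apply]
  · simp [← hI]
  · have hupdate : ∀ (m : Fin n → E) (i : Fin n) (c : ℂ) (w : E),
        γ (Function.update m i (c • w)) = c • γ (Function.update m i w) := fun m i c w => by
      have h := hγ (Function.update m i w) i
      rw [Function.update_self, Function.update_idem] at h
      rw [hsmul, γ.map_update_add, γ.map_update_smul, γ.map_update_smul, h]
      conv_rhs => rw [← Complex.re_add_im c]
      simp only [Complex.real_smul, smul_eq_mul]
      ring
    let γ' : E [⋀^Fin n]→ₗ[ℂ] ℂ :=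
      { γ with
        map_update_smul' := fun {inst} m i c w => by
          rw [Subsingleton.elim inst (instDecidableEqFin n)]
          exact hupdate m i c w }
    have := congrArg (fun f => f v) (γ'.eq_smul_basis_det b)
    simp only [AlternatingMap.smul_apply, Module.Basis.det_apply, hb, smul_eq_mul] at this
    exact this

/-- The conjugate of a multiple of a determinant of coordinate functionals. -/
theorem conjAlt_apply_of_eq_mul_det {E : Type*} [AddCommGroup E] [Module ℝ E] {n : ℕ}
    {β : E [⋀^Fin n]→ₗ[ℝ] ℂ} {b : ℂ} {z : Fin n → E →ₗ[ℝ] ℂ}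
    (hβ : ∀ w, β w = b * (Matrix.of fun i k => z i (w k)).det) (w : Fin n → E) :
    conjAlt β w = starRingEnd ℂ b *
      (Matrix.of fun i k =>
        (Complex.conjLIE.toLinearIsometry.toLinearMap ∘ₗ z i) (w k)).det := by
  have h : conjAlt β w = starRingEnd ℂ (β w) := rfl
  rw [h, hβ, map_mul, RingHom.map_det]
  rfl

/-- The half-form pairing formula: on a `2n`-dimensional symplectic vector
space `(E, ω)` with compatible positive complex structure `J`, let `Γ₁, Γ₂`
be transversal Lagrangian subspaces with `Γ₂` the graph of `JA` for a
symmetric endomorphism `A` of `JΓ₁`, and let `π₁, π₂` be the projections onto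
`Γ₁, Γ₂` along each other.  For `(n,0)`-forms `α, β` (alternating `ℂ`-valued
`n`-forms that are `J`-complex-linear), one has
`π₁*α ∧ π₂*β̄ = 2⁻ⁿ det(1 - iA) · (α ∧ β̄)`, i.e. in terms of the pairings
defined by dividing by `i^{n(2-n)} ωⁿ`: `(α, β)_{Γ₁,Γ₂} = 2⁻ⁿ det(1 - iA) (α, β)`. -/
theorem halfform_pairing_formula
    {E : Type*} [AddCommGroup E] [Module ℝ E] [FiniteDimensional ℝ E]
    {n : ℕ} (hdim : Module.finrank ℝ E = 2 * n)
    (ω : E →ₗ[ℝ] E →ₗ[ℝ] ℝ) (halt : ∀ x, ω x x = 0)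
    (hnondeg : ∀ x : E, (∀ y, ω x y = 0) → x = 0)
    (J : E →ₗ[ℝ] E) (hJ2 : J ∘ₗ J = -LinearMap.id)
    (hJcompat : ∀ x y, ω (J x) (J y) = ω x y)
    (hJpos : ∀ x : E, x ≠ 0 → 0 < ω x (J x))
    (Γ₁ Γ₂ : Submodule ℝ E)
    (hiso₁ : ∀ x ∈ Γ₁, ∀ y ∈ Γ₁, ω x y = 0) (hdim₁ : Module.finrank ℝ Γ₁ = n)
    (hiso₂ : ∀ x ∈ Γ₂, ∀ y ∈ Γ₂, ω x y = 0) (hdim₂ : Module.finrank ℝ Γ₂ = n)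
    (htrans : IsCompl Γ₁ Γ₂)
    (A : ↥(Γ₁.map J) →ₗ[ℝ] ↥(Γ₁.map J))
    (hsym : ∀ u v : ↥(Γ₁.map J), ω (A u : E) (J (v : E)) = ω (u : E) (J (A v : E)))
    (hgraph : Γ₂ = LinearMap.range ((Γ₁.map J).subtype + J ∘ₗ ((Γ₁.map J).subtype ∘ₗ A)))
    (α β : E [⋀^Fin n]→ₗ[ℝ] ℂ)
    (hα : ∀ (v : Fin n → E) (k : Fin n),
      α (Function.update v k (J (v k))) = Complex.I * α v)
    (hβ : ∀ (v : Fin n → E) (k : Fin n),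
      β (Function.update v k (J (v k))) = Complex.I * β v)
    (p₁ p₂ : E →ₗ[ℝ] E)
    (hp₁ : p₁ = Γ₁.subtype ∘ₗ Submodule.linearProjOfIsCompl Γ₁ Γ₂ htrans)
    (hp₂ : p₂ = Γ₂.subtype ∘ₗ Submodule.linearProjOfIsCompl Γ₂ Γ₁ htrans.symm) :
    wedgeC (α.compLinearMap p₁) (conjAlt (β.compLinearMap p₂)) =
      (((2 : ℂ) ^ n)⁻¹ *
          LinearMap.det
            (LinearMap.id - Complex.I • LinearMap.baseChange ℂ A)) •
        wedgeC α (conjAlt β) := by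
  replace hp₁ : p₁ = Γ₁.subtype ∘ₗ Γ₁.projectionOnto Γ₂ htrans := hp₁
  replace hp₂ : p₂ = Γ₂.subtype ∘ₗ Γ₂.projectionOnto Γ₁ htrans.symm := hp₂
  have hJJ : ∀ w, J (J w) = -w := fun w => by simpa using LinearMap.congr_fun hJ2 w
  have hJinj : Function.Injective J := fun u v h => by
    simpa [hJJ] using congrArg J h
  let b : Module.Basis (Fin n) ℝ Γ₁ := Module.finBasisOfFinrankEq ℝ Γ₁ hdim₁
  let b' := b.map (Submodule.equivMapOfInjective J hJinj Γ₁)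
  have hb' : ∀ k, (b' k : E) = J (b k) := fun k => rfl
  have hmem : ∀ x : Fin n → ℝ, ∑ k, x k • (b k : E) ∈ Γ₁ := fun x =>
    Submodule.sum_mem _ fun k _ => Γ₁.smul_mem _ (b k).2
  have hzero : ∀ x : Fin n → ℝ, ∑ k, x k • (b k : E) = 0 → x = 0 := fun x hx =>
    funext (Fintype.linearIndependent_iff.1 b.linearIndependent x
      (Subtype.ext (by simpa using hx)))
  have hframe : ∀ x y : Fin n → ℝ,
      ∑ k, x k • (b k : E) + J (∑ k, y k • (b k : E)) = 0 → x = 0 ∧ y = 0 := by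
    intro x y h
    have hy : ∑ k, y k • (b k : E) = 0 := by
      by_contra hne
      have hpos := hJpos _ hne
      rw [eq_neg_of_add_eq_zero_right h, map_neg, hiso₁ _ (hmem y) _ (hmem x)] at hpos
      simp at hpos
    rw [hy, map_zero, add_zero] at h
    exact ⟨hzero x h, hzero y hy⟩
  obtain ⟨z, hz, hze, hzJ, hzdet⟩ :=
    exists_complex_coordinates hdim J hJ2 (fun k => (b k : E)) hframe
  have hzsum : ∀ (x : Fin n → ℝ) k, z k (∑ j, x j • (b j : E)) = x k := fun x k => by
    simp [hze]
  let a := LinearMap.toMatrix b' b' A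
  have hA : ∀ y : Fin n → ℝ, (A (∑ k, y k • b' k) : E) =
      J (∑ k, (a.mulVec y) k • (b k : E)) := fun y => by
    have h := LinearMap.toMatrix_mulVec_repr b' b' A (∑ k, y k • b' k)
    rw [show ⇑(b'.repr (∑ k, y k • b' k)) = y by
      rw [← b'.equivFun_apply, ← b'.equivFun_symm_apply, LinearEquiv.apply_symm_apply]] at h
    rw [← b'.sum_repr (A (∑ k, y k • b' k)), ← h]
    simp [hb', a]
  have hproj : ∀ w, p₁ w = ∑ k, (z k w).re • (b k : E) +
        ∑ k, (a.mulVec fun j => (z j w).im) k • (b k : E) ∧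
      p₂ w = J (∑ k, (z k w).im • (b k : E)) -
        ∑ k, (a.mulVec fun j => (z j w).im) k • (b k : E) := by
    intro w
    set y : Fin n → ℝ := fun j => (z j w).im
    have h₁ := Γ₁.add_mem (hmem fun k => (z k w).re) (hmem (a.mulVec y))
    have h₂ : J (∑ k, y k • (b k : E)) - ∑ k, (a.mulVec y) k • (b k : E) ∈ Γ₂ := by
      rw [hgraph]
      refine ⟨∑ k, y k • b' k, ?_⟩
      simp only [LinearMap.add_apply, LinearMap.comp_apply, Submodule.subtype_apply, hA, hJJ]
      simp [hb', sub_eq_add_neg]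
    have hw : w = (∑ k, (z k w).re • (b k : E) + ∑ k, (a.mulVec y) k • (b k : E)) +
        (J (∑ k, y k • (b k : E)) - ∑ k, (a.mulVec y) k • (b k : E)) := by
      conv_lhs => rw [← hz w]
      abel
    constructor
    · conv_lhs => rw [hw]
      rw [hp₁, LinearMap.comp_apply, map_add,
        Submodule.projectionOnto_apply_of_mem_right htrans h₂, add_zero]
      exact congrArg Subtype.val (Submodule.projectionOnto_apply_left htrans ⟨_, h₁⟩)
    · conv_lhs => rw [hw]
      rw [hp₂, LinearMap.comp_apply, map_add,
        Submodule.projectionOnto_apply_of_mem_right htrans.symm h₁, zero_add]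
      exact congrArg Subtype.val (Submodule.projectionOnto_apply_left htrans.symm ⟨_, h₂⟩)
  have hz₁ : ∀ k w, z k (p₁ w) =
      (z k w).re + ∑ j, (a k j : ℂ) * (z j w).im := fun k w => by
    rw [(hproj w).1, map_add, hzsum, hzsum]
    simp [Matrix.mulVec, dotProduct]
  have hz₂ : ∀ k w, z k (p₂ w) =
      Complex.I * (z k w).im - ∑ j, (a k j : ℂ) * (z j w).im := fun k w => by
    rw [(hproj w).2, map_sub, hzJ, hzsum, hzsum]
    simp [Matrix.mulVec, dotProduct]
  let aC : Matrix (Fin n) (Fin n) ℂ := a.map (algebraMap ℝ ℂ)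
  have hdet : LinearMap.det (LinearMap.id - Complex.I • LinearMap.baseChange ℂ A) =
      (1 - Complex.I • aC).det := by
    rw [← LinearMap.det_toMatrix (Algebra.TensorProduct.basis ℂ b'), map_sub, map_smul,
      LinearMap.toMatrix_baseChange, LinearMap.toMatrix_id]
  ext v
  rw [AlternatingMap.smul_apply,
    wedgeC_apply_of_eq_mul_det (x := fun i => z i ∘ₗ p₁) (fun w => hzdet α hα (p₁ ∘ w))
      (conjAlt_apply_of_eq_mul_det (z := fun i => z i ∘ₗ p₂) fun w => hzdet β hβ (p₂ ∘ w)),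
    wedgeC_apply_of_eq_mul_det (hzdet α hα) (conjAlt_apply_of_eq_mul_det (hzdet β hβ)), hdet]
  let N : Matrix (Fin n ⊕ Fin n) (Fin n ⊕ Fin n) ℂ := Matrix.of fun i k =>
    Sum.elim (fun i => ((z i (v (finSumFinEquiv k))).re : ℂ))
      (fun i => ((z i (v (finSumFinEquiv k))).im : ℂ)) i
  have hL : (Matrix.of fun i k => Sum.elim (fun i => z i ∘ₗ p₁)
      (fun i => Complex.conjLIE.toLinearIsometry.toLinearMap ∘ₗ (z i ∘ₗ p₂)) i
        (v (finSumFinEquiv k))) =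
      Matrix.fromBlocks 1 aC 0 (-Complex.I • (1 - Complex.I • aC)) * N := by
    ext i k
    rcases i with i | i
    · simp [Matrix.mul_apply, N, hz₁, aC, Matrix.one_apply]
    · simp [Matrix.mul_apply, N, hz₂, aC, Matrix.one_apply, mul_sub, ← mul_assoc, add_mul,
        Finset.sum_add_distrib]
      ring
  have hR : (Matrix.of fun i k => Sum.elim z
      (fun i => Complex.conjLIE.toLinearIsometry.toLinearMap ∘ₗ z i) i
        (v (finSumFinEquiv k))) =
      Matrix.fromBlocks 1 (Complex.I • 1) 1 (-Complex.I • 1) * N := by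
    ext i k
    rcases i with i | i
    · simp [Matrix.mul_apply, N, Matrix.one_apply, mul_comm Complex.I, Complex.re_add_im]
    · simp [Matrix.mul_apply, N, Matrix.one_apply]
      apply Complex.ext <;> simp
  rw [hL, hR, Matrix.det_mul, Matrix.det_mul, Matrix.det_fromBlocks_zero₂₁,
    Matrix.det_fromBlocks_one₁₁, one_mul, ← sub_smul, Matrix.det_smul, Matrix.det_smul,
    Matrix.det_one, Fintype.card_fin,
    show -Complex.I - Complex.I = 2 * -Complex.I by ring, mul_pow, smul_eq_mul]
  field_simp
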